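/- For all integers k ≥ k' ≥ 0, the identity Σ_{i=0}^{k} (−1)^{k+i}·binom[2k, k−i]·([2i+1]/[k+i+1])·binom[k'+i, 2k'] = (1 if k = k', and 0 if k > k') holds in ℚ(v). (This expresses that the two triangular transformations f_i = Σ_{k=0}^{i} binom[k+i,2k]·a_{−k−1} and a_{−k−1} = Σ_{i=0}^{k} (−1)^{k+i}·binom[2k,k−i]·([2i+1]/[k+i+1])·f_i are mutually inverse, so the coefficients of the inverted Habiro series and of the Gukov–Manolescu series determine each other.) -/

import Mathlib

/-!
STATEMENT 5: For all integers k ≥ k' ≥ 0, the identity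
Σ_{i=0}^{k} (−1)^{k+i}·binom[2k, k−i]·([2i+1]/[k+i+1])·binom[k'+i, 2k']
  = (1 if k = k', and 0 if k > k')
holds in ℚ(v).
-/

noncomputable section

/-- The variable `v` of the field `ℚ(v)`. -/
def V : RatFunc ℚ := RatFunc.X

/-- `{n} = vⁿ − v⁻ⁿ`. -/
def sm (n : ℤ) : RatFunc ℚ := V ^ n - V ^ (-n)

/-- `{n}_k = {n}{n−1}⋯{n−k+1}`. -/
def smP (n : ℤ) (k : ℕ) : RatFunc ℚ := ∏ i ∈ Finset.range k, sm (n - i)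

/-- The balanced Gaussian binomial `binom[n,k] = {n}_k/{k}_k`. -/
def bbinom (n : ℤ) (k : ℕ) : RatFunc ℚ := smP n k / smP k k

/-- The balanced quantum integer `[n] = {n}/{1}`. -/
def qint (n : ℤ) : RatFunc ℚ := sm n / sm 1

lemma V_ne : V ≠ 0 := RatFunc.X_ne_zero

lemma sm_ne (n : ℕ) : sm ((n : ℤ) + 1) ≠ 0 := by
  intro h
  unfold sm at h
  have h1 : V ^ ((n : ℤ) + 1) = V ^ (-((n : ℤ) + 1)) := sub_eq_zero.mp h
  have h2 : V ^ (2 * n + 2) = 1 := by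
    have : V ^ (((2 * n + 2 : ℕ)) : ℤ) = 1 := by
      have e : (((2 * n + 2 : ℕ)) : ℤ) = ((n : ℤ) + 1) + ((n : ℤ) + 1) := by push_cast; ring
      rw [e, zpow_add₀ V_ne]
      nth_rewrite 1 [h1]
      rw [← zpow_add₀ V_ne]; simp
    exact_mod_cast this
  unfold V at h2
  rw [← RatFunc.algebraMap_X, ← map_pow, ← map_one (algebraMap (Polynomial ℚ) (RatFunc ℚ))] at h2
  have h3 := RatFunc.algebraMap_injective ℚ h2
  have h4 := congrArg Polynomial.natDegree h3
  simp at h4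

lemma sm_zero : sm 0 = 0 := by simp [sm]

/-- quantum factorial -/
def qF (n : ℕ) : RatFunc ℚ := smP n n

lemma smP_succ (n : ℤ) (k : ℕ) : smP (n + 1) (k + 1) = sm (n + 1) * smP n k := by
  unfold smP
  rw [Finset.prod_range_succ', mul_comm]
  congr 1
  · simp
  · refine Finset.prod_congr rfl fun i _ => ?_
    congr 1; push_cast; ring

lemma qF_succ (n : ℕ) : qF (n + 1) = sm ((n : ℤ) + 1) * qF n := by
  unfold qF
  rw [← smP_succ]; push_cast; rfl

lemma qF_zero : qF 0 = 1 := by simp [qF, smP]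

lemma qF_ne (n : ℕ) : qF n ≠ 0 := by
  induction n with
  | zero => simp [qF_zero]
  | succ n ih => rw [qF_succ]; exact mul_ne_zero (sm_ne n) ih

lemma smP_mul (a b : ℕ) : smP ((a : ℤ) + b) a * qF b = qF (a + b) := by
  induction a with
  | zero => simp [smP]
  | succ a ih =>
    have e : (((a + 1 : ℕ) : ℤ) + b) = ((a : ℤ) + b) + 1 := by push_cast; ring
    have e2 : a + 1 + b = (a + b) + 1 := by ring
    rw [e, smP_succ, mul_assoc, ih, e2, qF_succ]; push_cast; rfl

lemma bbinom_eq (n : ℤ) (a b : ℕ) (h : n = (a : ℤ) + b) :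
    bbinom n a = qF (a + b) / (qF a * qF b) := by
  subst h
  have := qF_ne a
  have := qF_ne b
  have e : bbinom ((a : ℤ) + b) a = smP ((a : ℤ) + b) a / qF a := rfl
  rw [e, ← smP_mul]
  field_simp

lemma bbinom_zero (n : ℤ) (a i : ℕ) (hi : i < a) (h : n = i) : bbinom n a = 0 := by
  subst h
  unfold bbinom smP
  rw [Finset.prod_eq_zero (Finset.mem_range.mpr hi) (by simp [sm_zero])]
  simp

lemma sm_key (a b c : ℤ) :
    sm (a + 1) * sm b + sm (a + b + c + 1) * sm c = sm (a + 2 * c + 1 - c) * sm (b + c) := by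
  unfold sm
  have e : ∀ x y : ℤ, (V ^ x - V ^ (-x)) * (V ^ y - V ^ (-y))
      = V ^ (x + y) - V ^ (x - y) - V ^ (y - x) + V ^ (-(x + y)) := by
    intro x y
    have h1 : x - y = x + -y := by ring
    have h2 : y - x = -x + y := by ring
    have h3 : -(x + y) = -x + -y := by ring
    rw [h1, h2, h3]
    simp only [zpow_add₀ V_ne]; ring
  rw [e, e, e]
  ring_nf

/-- the summand in factorial form -/
def qX (p d j : ℕ) : RatFunc ℚ :=
  (-1) ^ j * qF (2 * p + j) / (qF (d - j) * qF (2 * p + d + j + 1) * qF j)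

lemma partial_sum (p d n : ℕ) (h : n ≤ d) :
    (∑ j ∈ Finset.range (n + 1), qX p d j * sm (2 * (p + j) + 1)) * sm d
      = qX p d n * sm (2 * p + n + 1) * sm (d - n) := by
  induction n with
  | zero => simp
  | succ n ih =>
    rw [Finset.sum_range_succ, add_mul, ih (by omega)]
    obtain ⟨m, rfl⟩ := Nat.exists_eq_add_of_le h
    have hs : qX p (n + 1 + m) n * sm (2 * p + n + 1) * sm (((n + 1 + m : ℕ) : ℤ) - n)
        = - (qX p (n + 1 + m) (n + 1) * sm (2 * p + 2 * n + m + 3) * sm ((n : ℤ) + 1)) := by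
      unfold qX
      have e1 : n + 1 + m - n = m + 1 := by omega
      have e2 : n + 1 + m - (n + 1) = m := by omega
      have e3 : 2 * p + (n + 1 + m) + (n + 1) + 1 = (2 * p + (n + 1 + m) + n + 1) + 1 := by ring
      have e4 : 2 * p + (n + 1) = (2 * p + n) + 1 := by ring
      rw [e1, e2, e3, e4, qF_succ m, qF_succ n, qF_succ (2 * p + n),
        qF_succ (2 * p + (n + 1 + m) + n + 1)]
      have f1 : ((n + 1 + m : ℕ) : ℤ) - n = (m : ℤ) + 1 := by push_cast; ring
      have f2 : ((2 * p + (n + 1 + m) + n + 1 : ℕ) : ℤ) + 1 = 2 * p + 2 * n + m + 3 := by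
        push_cast; ring
      have f3 : ((2 * p + n : ℕ) : ℤ) + 1 = 2 * p + n + 1 := by push_cast; ring
      have g1 := sm_ne m
      have g2 := sm_ne n
      have g3 := sm_ne (2 * p + (n + 1 + m) + n + 1)
      rw [f2] at g3
      rw [f1, f2, f3]
      have := qF_ne m
      have := qF_ne n
      have := qF_ne (2 * p + (n + 1 + m) + n + 1)
      field_simp
      ring
    rw [hs]
    have k1 := sm_key (2 * p + n + 1) m (n + 1)
    have f1 : ((n + 1 + m : ℕ) : ℤ) = m + (n + 1) := by push_cast; ring
    have f2 : (2 * ((p : ℤ) + ((n + 1 : ℕ) : ℤ)) + 1) = 2 * p + n + 1 + 2 * (n + 1) + 1 - (n + 1) := by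
      push_cast; ring
    have f3 : (2 * (p : ℤ) + ((n + 1 : ℕ) : ℤ) + 1) = 2 * p + n + 1 + 1 := by push_cast; ring
    have f4 : (2 * (p : ℤ) + 2 * n + m + 3) = 2 * p + n + 1 + m + (n + 1) + 1 := by ring
    have f5 : ((m : ℤ) + (n + 1)) - ((n + 1 : ℕ) : ℤ) = m := by push_cast; ring
    rw [f1, f2, f3, f4, f5, mul_assoc (qX _ _ _) (sm (2 * p + n + 1 + 2 * (n + 1) + 1 - (n + 1))),
      ← k1]
    ring

lemma term_eq (p d j : ℕ) (h : j ≤ d) :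
    (-1 : RatFunc ℚ) ^ (p + d + (p + j)) * bbinom (2 * (p + d : ℕ)) (p + d - (p + j)) *
          (qint (2 * (p + j : ℕ) + 1) / qint ((p + d : ℕ) + (p + j : ℕ) + 1)) *
          bbinom (p + (p + j : ℕ)) (2 * p)
      = (-1) ^ d * qF (2 * (p + d)) / qF (2 * p) * (qX p d j * sm (2 * (p + j) + 1)) := by
  have e0 : p + d - (p + j) = d - j := by omega
  rw [e0, bbinom_eq _ (d - j) (2 * p + d + j) (by push_cast [Nat.cast_sub h]; ring),
    bbinom_eq _ (2 * p) j (by push_cast; ring)]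
  have e1 : d - j + (2 * p + d + j) = 2 * (p + d) := by omega
  rw [e1]
  unfold qX qint
  rw [qF_succ (2 * p + d + j)]
  have f1 : ((p + d : ℕ) : ℤ) + (p + j : ℕ) + 1 = ((2 * p + d + j : ℕ) : ℤ) + 1 := by
    push_cast; ring
  have f2 : (2 * ((p + j : ℕ) : ℤ) + 1) = 2 * (p + j) + 1 := by push_cast; ring
  have f3 : (-1 : RatFunc ℚ) ^ (p + d + (p + j)) = (-1) ^ d * (-1) ^ j := by
    rw [show p + d + (p + j) = 2 * p + (d + j) by ring, pow_add, pow_mul, pow_add]; simp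
  rw [f1, f2, f3]
  have g1 := sm_ne (2 * p + d + j)
  have g2 : sm 1 ≠ 0 := by simpa using sm_ne 0
  have := qF_ne (d - j)
  have := qF_ne j
  have := qF_ne (2 * p)
  have := qF_ne (2 * p + d + j)
  field_simp

theorem transformations_mutually_inverse (k k' : ℕ) (h : k' ≤ k) :
    ∑ i ∈ Finset.range (k + 1),
        (-1 : RatFunc ℚ) ^ (k + i) * bbinom (2 * k) (k - i) *
          (qint (2 * i + 1) / qint (k + i + 1)) * bbinom (k' + i) (2 * k')
      = if k = k' then 1 else 0 := by
  obtain ⟨d, rfl⟩ := Nat.exists_eq_add_of_le h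
  rw [add_assoc, Finset.sum_range_add, Finset.sum_eq_zero, zero_add]
  swap
  · intro i hi
    have hi' := Finset.mem_range.mp hi
    rw [bbinom_zero _ (2 * k') (k' + i) (by omega) (by push_cast; ring), mul_zero]
  rw [Finset.sum_congr rfl fun j hj =>
    term_eq k' d j (by have := Finset.mem_range.mp hj; omega), ← Finset.mul_sum]
  rcases Nat.eq_zero_or_pos d with rfl | hd
  · have g := sm_ne (2 * k')
    have := qF_ne (2 * k')
    push_cast at g
    simp [qX, qF_succ, qF_zero]
    field_simp
  · have hp := partial_sum k' d d le_rfl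
    rw [sub_self, sm_zero, mul_zero] at hp
    obtain ⟨e, rfl⟩ := Nat.exists_eq_add_of_le hd
    have g := sm_ne e
    have e1 : ((1 + e : ℕ) : ℤ) = (e : ℤ) + 1 := by push_cast; ring
    rw [Nat.succ_eq_add_one, zero_add] at hp
    rw [e1] at hp
    rcases mul_eq_zero.mp hp with h0 | h0
    · rw [Nat.succ_eq_add_one, zero_add, h0, mul_zero, if_neg (by omega)]
    · exact absurd h0 g
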